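/- arXiv:math/0401197 — 2 statements merged into one kernel-verified Lean document; each statement's English description precedes it below -/
import Mathlib

section
/- Let 𝒯_p = ⟨T_{e_1},…,T_{e_p}⟩ be the maximal translation subgroup of Γ_p. The number of right cosets of 𝒯_p in Γ_p possessing a representative (a,b;c,d) with c = 0 equals exactly 2^{p+1}. Consequently, for every congruence subgroup Λ ⊆ Γ_p with translation subgroup T(Λ), the number of right cosets of T(Λ) in Λ possessing a representative with c = 0 is at least 1 and at most 2^{p+1}; and for Γ_p[N] with N ≥ 3 this number equals exactly 1. -/
noncomputable section

open CliffordAlgebra Filter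

attribute [local instance] Classical.propDecidable

/-- The quadratic form `-(x₁² + ⋯ + xₙ²)` on `ℝⁿ`, so that in the associated Clifford
algebra one has `x * x = -‖x‖²`, i.e. `eᵢeⱼ + eⱼeᵢ = -2δᵢⱼ`. -/
def Qf (n : ℕ) : QuadraticForm ℝ (Fin n → ℝ) :=
  QuadraticMap.weightedSumSquares ℝ (fun _ : Fin n => (-1 : ℝ))

/-- The real Clifford algebra `Cl_n`. -/
abbrev Cl (n : ℕ) := CliffordAlgebra (Qf n)

/-- The embedding of a vector of `ℝⁿ` into `Cl_n`. -/
def clVec {n : ℕ} (x : Fin n → ℝ) : Cl n := CliffordAlgebra.ι (Qf n) x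

/-- The canonical basis vectors `e_i` inside `Cl_n` (0-indexed: `eCl i` is `e_{i+1}`). -/
def eCl {n : ℕ} (i : Fin n) : Cl n := clVec (Pi.single i 1)

/-- The reversion anti-automorphism `a ↦ a*`. -/
def clRev {n : ℕ} (a : Cl n) : Cl n := CliffordAlgebra.reverse a

/-- The conjugation anti-automorphism `a ↦ ā` (reversion composed with grade involution). -/
def clConj {n : ℕ} (a : Cl n) : Cl n := CliffordAlgebra.reverse (CliffordAlgebra.involute a)

/-- `(a*)‾`, the conjugate of the reversion of `a`. -/
def crev {n : ℕ} (a : Cl n) : Cl n := clConj (clRev a)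

/-- The scalar part `Sc a` of a Clifford number (the coefficient of `e_∅ = 1`). -/
def Sc {n : ℕ} (a : Cl n) : ℝ :=
  ExteriorAlgebra.algebraMapInv ((CliffordAlgebra.equivExterior (Qf n)) a)

/-- The vector (grade-one) part of a Clifford number, as an element of `ℝⁿ`. -/
def vecPart {n : ℕ} (a : Cl n) : Fin n → ℝ :=
  ExteriorAlgebra.ιInv ((CliffordAlgebra.equivExterior (Qf n)) a)

/-- The Clifford norm `‖a‖ = (Σ_A a_A²)^{1/2} = (Sc (a ā))^{1/2}`. -/
def clNorm {n : ℕ} (a : Cl n) : ℝ := Real.sqrt (Sc (a * clConj a))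

/-- The last ("vertical") coordinate `x_n` of a vector `x ∈ ℝⁿ`. -/
def lastc (n : ℕ) (x : Fin n → ℝ) : ℝ :=
  if h : 0 < n then x ⟨n - 1, by omega⟩ else 0

/-- The upper half-space `H⁺(ℝⁿ) = {x ∈ ℝⁿ : x_n > 0}`. -/
def upH (n : ℕ) : Set (Fin n → ℝ) := {x | 0 < lastc n x}

/-- Replace the last coordinate of `x` by `t`. -/
def setLast {n : ℕ} (x : Fin n → ℝ) (t : ℝ) : Fin n → ℝ :=
  fun j => if (j : ℕ) = n - 1 then t else x j

/-- The last basis vector `e_n` of `ℝⁿ`. -/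
def enVec (n : ℕ) : Fin n → ℝ := fun j => if (j : ℕ) = n - 1 then 1 else 0

/-- `ω ∈ ℤ^{n-1} = ℤe₁ + ⋯ + ℤe_{n-1}`: an integer vector with vanishing last coordinate. -/
def horPart (n : ℕ) (ω : Fin n → ℤ) : Prop := ∀ j : Fin n, (j : ℕ) = n - 1 → ω j = 0

/-- The real vector associated to an integer lattice point. -/
def latVec {n : ℕ} (ω : Fin n → ℤ) : Fin n → ℝ := fun j => (ω j : ℝ)

/-- The vertical strip `V_ε(H⁺(ℝⁿ))`. -/
def Vstrip (n : ℕ) (ε : ℝ) : Set (Fin n → ℝ) :=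
  {x | clNorm (clVec (setLast x 0)) ≤ 1 / ε ∧ ε < lastc n x}

/-- The kernel `q^{(s)}_0`, evaluated on a Clifford number:
`q^{(s)}_0(a) = a/‖a‖^{n+1-s}` for odd `s`, `q^{(s)}_0(a) = 1/‖a‖^{n-s}` for even `s`. -/
def qker {n : ℕ} (s : ℕ) (a : Cl n) : Cl n :=
  if Odd s then ((clNorm a) ^ (n + 1 - s))⁻¹ • a
  else algebraMap ℝ (Cl n) ((clNorm a ^ (n - s))⁻¹)

/-- `q^{(s)}_0` as a function on `ℝⁿ`. -/
def qfun {n : ℕ} (s : ℕ) (x : Fin n → ℝ) : Cl n := qker s (clVec x)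

/-- The `i`-th partial derivative of a `Cl_n`-valued function, detected componentwise
through all real-linear functionals. -/
def clPDeriv {n : ℕ} (i : Fin n) (f : (Fin n → ℝ) → Cl n) (x : Fin n → ℝ) : Cl n :=
  if h : ∃ v : Cl n, ∀ φ : Cl n →ₗ[ℝ] ℝ,
      HasDerivAt (fun t : ℝ => φ (f (Function.update x i (x i + t)))) (φ v) 0
  then h.choose else 0

/-- The (left) Euclidean Dirac operator `D f = Σ eᵢ ∂f/∂xᵢ`. -/
def Dirac {n : ℕ} (f : (Fin n → ℝ) → Cl n) (x : Fin n → ℝ) : Cl n :=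
  ∑ i : Fin n, eCl i * clPDeriv i f x

/-- The right Euclidean Dirac operator `f D = Σ (∂f/∂xᵢ) eᵢ`. -/
def DiracR {n : ℕ} (f : (Fin n → ℝ) → Cl n) (x : Fin n → ℝ) : Cl n :=
  ∑ i : Fin n, clPDeriv i f x * eCl i

/-- The iterated Dirac operator `D^s`. -/
def DiracIter {n : ℕ} : ℕ → ((Fin n → ℝ) → Cl n) → ((Fin n → ℝ) → Cl n)
  | 0, f => f
  | (s + 1), f => Dirac (DiracIter s f)

/-- The iterated right Dirac operator. -/
def DiracRIter {n : ℕ} : ℕ → ((Fin n → ℝ) → Cl n) → ((Fin n → ℝ) → Cl n)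
  | 0, f => f
  | (s + 1), f => DiracR (DiracRIter s f)

/-- The `i`-th partial derivative of a real-valued function. -/
def pdR {n : ℕ} (i : Fin n) (g : (Fin n → ℝ) → ℝ) (x : Fin n → ℝ) : ℝ :=
  deriv (fun t : ℝ => g (Function.update x i (x i + t))) 0

/-- Iterated partial derivative in one fixed direction. -/
def clPDerivIter {n : ℕ} (i : Fin n) : ℕ → ((Fin n → ℝ) → Cl n) → ((Fin n → ℝ) → Cl n)
  | 0, f => f
  | (k + 1), f => clPDeriv i (clPDerivIter i k f)

/-- The mixed partial derivative `∂^{|m|}/∂x^m` for a multi-index `m ∈ ℕ₀ⁿ`. -/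
def multiPDeriv {n : ℕ} (m : Fin n → ℕ) (f : (Fin n → ℝ) → Cl n) : (Fin n → ℝ) → Cl n :=
  (List.finRange n).foldr (fun i g => clPDerivIter i (m i) g) f

/-- Convergence of a series of Clifford numbers to `a`, detected componentwise through
all real-linear functionals. -/
def HasClSum {n : ℕ} {ι : Type*} (g : ι → Cl n) (a : Cl n) : Prop :=
  ∀ φ : Cl n →ₗ[ℝ] ℝ, HasSum (fun i => φ (g i)) (φ a)

/-- Index set for the Eisenstein series `G_m`: `(α,ω) ∈ ℤ × ℤ^{n-1}`, `(α,ω) ≠ (0,0)`. -/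
def GmIdx (n : ℕ) : Type := {v : ℤ × (Fin n → ℤ) // horPart n v.2 ∧ v ≠ 0}

/-- The summand `q^{(1)}_m(αx + ω)` of the monogenic Eisenstein series `G_m`. -/
def Gterm {n : ℕ} (m : Fin n → ℕ) (x : Fin n → ℝ) (v : GmIdx n) : Cl n :=
  multiPDeriv m (qfun 1) ((v.1.1 : ℝ) • x + latVec v.1.2)

/-- The monogenic Eisenstein series `G_m(x) = Σ_{(α,ω) ≠ 0} q^{(1)}_m(αx + ω)`. -/
def Gm {n : ℕ} (m : Fin n → ℕ) (x : Fin n → ℝ) : Cl n :=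
  if h : ∃ a : Cl n, HasClSum (Gterm m x) a then h.choose else 0
/-- The group of invertible `2 × 2` matrices with entries in `Cl_n`. -/
abbrev GL2 (n : ℕ) := (Matrix (Fin 2) (Fin 2) (Cl n))ˣ

/-- The `(i,j)` entry of an invertible Clifford matrix. -/
def ent {n : ℕ} (M : GL2 n) (i j : Fin 2) : Cl n :=
  M.val i j

/-- The translation matrix `T_b = (1, b; 0, 1)`. -/
def Tmat {n : ℕ} (b : Cl n) : GL2 n where
  val := !![1, b; 0, 1]
  inv := !![1, -b; 0, 1]
  val_inv := by
    ext i j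
    fin_cases i <;> fin_cases j <;>
      simp [Matrix.mul_apply, Fin.sum_univ_two, Matrix.one_apply]
  inv_val := by
    ext i j
    fin_cases i <;> fin_cases j <;>
      simp [Matrix.mul_apply, Fin.sum_univ_two, Matrix.one_apply]

/-- The inversion matrix `J = (0, -1; 1, 0)`. -/
def Jmat (n : ℕ) : GL2 n where
  val := !![0, -1; 1, 0]
  inv := !![0, 1; -1, 0]
  val_inv := by
    ext i j
    fin_cases i <;> fin_cases j <;>
      simp [Matrix.mul_apply, Fin.sum_univ_two, Matrix.one_apply]
  inv_val := by
    ext i j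
    fin_cases i <;> fin_cases j <;>
      simp [Matrix.mul_apply, Fin.sum_univ_two, Matrix.one_apply]

/-- The special hypercomplex modular group `Γ_p = ⟨T_{e_1}, …, T_{e_p}, J⟩`. -/
def Gamma (n p : ℕ) : Subgroup (GL2 n) :=
  Subgroup.closure ({Jmat n} ∪ {M | ∃ i : Fin n, (i : ℕ) < p ∧ M = Tmat (eCl i)})

/-- The standard order `O_p = Σ_{A ⊆ {1,…,p}} ℤ e_A` in `Cl_n`: the subring generated by
`e_1, …, e_p`. -/
def Op (n p : ℕ) : Set (Cl n) :=
  Subring.closure {a : Cl n | ∃ i : Fin n, (i : ℕ) < p ∧ a = eCl i}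

/-- `a ∈ N·O_p`. -/
def inNOp (n p N : ℕ) (a : Cl n) : Prop := ∃ y ∈ Op n p, a = (N : ℕ) • y

/-- The principal congruence subgroup `Γ_p[N]` of level `N` (as a set of matrices). -/
def GammaN (n p N : ℕ) : Set (GL2 n) :=
  {M | M ∈ Gamma n p ∧ inNOp n p N (ent M 0 0 - 1) ∧ inNOp n p N (ent M 0 1) ∧
    inNOp n p N (ent M 1 0) ∧ inNOp n p N (ent M 1 1 - 1)}

/-- The congruence group `Γ_p^0[N] = {M ∈ Γ_p : b ∈ N·O_p}`. -/
def Gamma0Upper (n p N : ℕ) : Set (GL2 n) :=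
  {M | M ∈ Gamma n p ∧ inNOp n p N (ent M 0 1)}

/-- The congruence group `Γ_{p,0}[N] = {M ∈ Γ_p : c ∈ N·O_p}`. -/
def Gamma0Lower (n p N : ℕ) : Set (GL2 n) :=
  {M | M ∈ Gamma n p ∧ inNOp n p N (ent M 1 0)}

/-- The generalized theta group `Γ_{p,θ} = Γ_p[2] ∪ Γ_p[2]·J`. -/
def GammaTheta (n p : ℕ) : Set (GL2 n) :=
  GammaN n p 2 ∪ (fun M => M * Jmat n) '' GammaN n p 2

/-- `Λ` is a congruence subgroup of `Γ_p`: `Γ_p[N] ⊆ Λ ⊆ Γ_p` for some `N ≥ 1`. -/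
def IsCongruence (n p : ℕ) (Λ : Subgroup (GL2 n)) : Prop :=
  ∃ N : ℕ, 0 < N ∧ GammaN n p N ⊆ (Λ : Set (GL2 n)) ∧ (Λ : Set (GL2 n)) ⊆ Gamma n p

/-- `M` is a translation matrix `(1, b; 0, 1)`. -/
def IsTransMat {n : ℕ} (M : GL2 n) : Prop :=
  ∃ b : Cl n, M.val = !![1, b; 0, 1]

/-- `R : ι → GL2 n` is a system of representatives for the right cosets `T(Λ)\Λ` of the
subgroup of translation matrices `T(Λ)` contained in `Λ`: each member of `Λ` can be written
uniquely as `T * R i` with `T` a translation matrix of `Λ`. -/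
def IsRepSystem (n : ℕ) (Λ : Subgroup (GL2 n)) (ι : Type*) (R : ι → GL2 n) : Prop :=
  (∀ i, R i ∈ Λ) ∧
  (∀ M ∈ Λ, ∃! i : ι, ∃ T : GL2 n, IsTransMat T ∧ T ∈ Λ ∧ M = T * R i)

/-- The Möbius transformation `M⟨x⟩ = (ax+b)(cx+d)⁻¹` associated with a Clifford matrix,
as a map on `ℝⁿ`. -/
def mobius {n : ℕ} (M : GL2 n) (x : Fin n → ℝ) : Fin n → ℝ :=
  vecPart ((ent M 0 0 * clVec x + ent M 0 1) *
    Ring.inverse (ent M 1 0 * clVec x + ent M 1 1))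

/-- `a` is a (finite) product of vectors of `ℝⁿ`. -/
def IsProdVec {n : ℕ} (a : Cl n) : Prop :=
  ∃ l : List (Fin n → ℝ), a = (l.map (fun v => clVec v)).prod

/-- Membership in the general Vahlen group `GV(ℝⁿ)`. -/
def IsVahlen {n : ℕ} (M : Matrix (Fin 2) (Fin 2) (Cl n)) : Prop :=
  IsProdVec (M 0 0) ∧ IsProdVec (M 0 1) ∧ IsProdVec (M 1 0) ∧ IsProdVec (M 1 1) ∧
  (∃ r : ℝ, r ≠ 0 ∧ M 0 0 * clRev (M 1 1) - M 0 1 * clRev (M 1 0) = algebraMap ℝ (Cl n) r) ∧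
  (M 0 0 ≠ 0 → ∃ v : Fin n → ℝ, Ring.inverse (M 0 0) * M 0 1 = clVec v) ∧
  (M 1 0 ≠ 0 → ∃ v : Fin n → ℝ, Ring.inverse (M 1 0) * M 1 1 = clVec v)

/-! ### The regular representation on functions of Boolean vectors -/

/-- Flip the `i`-th bit. -/
def flipB {n : ℕ} (i : Fin n) (A : Fin n → Bool) : Fin n → Bool :=
  Function.update A i (!(A i))

lemma flipB_same {n : ℕ} (i : Fin n) (A : Fin n → Bool) : flipB i A i = !(A i) := by
  simp [flipB]

lemma flipB_ne {n : ℕ} {i j : Fin n} (h : j ≠ i) (A : Fin n → Bool) : flipB i A j = A j := by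
  simp [flipB, h]

lemma flipB_flipB {n : ℕ} (i : Fin n) (A : Fin n → Bool) : flipB i (flipB i A) = A := by
  funext j
  by_cases h : j = i
  · subst h; simp [flipB_same]
  · simp [flipB_ne h]

lemma flipB_comm {n : ℕ} (i j : Fin n) (A : Fin n → Bool) :
    flipB i (flipB j A) = flipB j (flipB i A) := by
  by_cases hij : i = j
  · rw [hij]
  funext k
  by_cases h : k = i
  · subst h; simp [flipB_same, flipB_ne hij]
  · by_cases h' : k = j
    · subst h'; simp [flipB_same, flipB_ne h]
    · simp [flipB_ne h, flipB_ne h']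

/-- Boolean sign. -/
def bsgn (b : Bool) : ℝ := if b then 1 else -1

lemma bsgn_not (b : Bool) : bsgn (!b) = - bsgn b := by cases b <;> simp [bsgn]

lemma bsgn_sq (b : Bool) : bsgn b * bsgn b = 1 := by cases b <;> simp [bsgn]

/-- The sign of the action of `e_i` in position `A`. -/
def sg {n : ℕ} (i : Fin n) (A : Fin n → Bool) : ℝ :=
  bsgn (A i) * ∏ j ∈ Finset.Iio i, (- bsgn (A j))

lemma sg_flip_same {n : ℕ} (i : Fin n) (A : Fin n → Bool) : sg i (flipB i A) = - sg i A := by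
  unfold sg
  rw [flipB_same, bsgn_not, neg_mul]
  congr 2
  refine Finset.prod_congr rfl fun j hj => ?_
  rw [flipB_ne (ne_of_lt (Finset.mem_Iio.1 hj))]

lemma sg_flip_gt {n : ℕ} {i j : Fin n} (h : i < j) (A : Fin n → Bool) :
    sg i (flipB j A) = sg i A := by
  unfold sg
  rw [flipB_ne (ne_of_lt h)]
  congr 1
  refine Finset.prod_congr rfl fun k hk => ?_
  rw [flipB_ne (ne_of_lt ((Finset.mem_Iio.1 hk).trans h))]

lemma sg_flip_lt {n : ℕ} {i j : Fin n} (h : j < i) (A : Fin n → Bool) :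
    sg i (flipB j A) = - sg i A := by
  unfold sg
  rw [flipB_ne (ne_of_gt h)]
  rw [← Finset.mul_prod_erase _ _ (Finset.mem_Iio.2 h),
    ← Finset.mul_prod_erase (Finset.Iio i) (fun j => - bsgn (A j)) (Finset.mem_Iio.2 h)]
  rw [flipB_same, bsgn_not]
  have : ∏ x ∈ (Finset.Iio i).erase j, (- bsgn (flipB j A x))
      = ∏ x ∈ (Finset.Iio i).erase j, (- bsgn (A x)) := by
    refine Finset.prod_congr rfl fun k hk => ?_
    rw [flipB_ne (Finset.ne_of_mem_erase hk)]
  rw [this]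
  ring

lemma sg_sq {n : ℕ} (i : Fin n) (A : Fin n → Bool) : sg i A * sg i A = 1 := by
  unfold sg
  rw [mul_mul_mul_comm, bsgn_sq, ← Finset.prod_mul_distrib]
  simp [bsgn_sq]

lemma sg_pm {n : ℕ} (i : Fin n) (A : Fin n → Bool) : sg i A = 1 ∨ sg i A = -1 :=
  mul_self_eq_one_iff.1 (sg_sq i A)

/-- The representation space. -/
abbrev RepV (n : ℕ) := (Fin n → Bool) → ℝ

/-- The operator representing `e_i`. -/
def Eop {n : ℕ} (i : Fin n) : Module.End ℝ (RepV n) where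
  toFun f := fun A => sg i A * f (flipB i A)
  map_add' f g := by funext A; simp [mul_add]
  map_smul' r f := by funext A; simp; ring

lemma Eop_apply {n : ℕ} (i : Fin n) (f : RepV n) (A : Fin n → Bool) :
    Eop i f A = sg i A * f (flipB i A) := rfl

lemma Eop_sq {n : ℕ} (i : Fin n) : Eop i * Eop i = (-1 : Module.End ℝ (RepV n)) := by
  refine LinearMap.ext fun f => funext fun A => ?_
  simp only [Module.End.mul_apply, Eop_apply, flipB_flipB, sg_flip_same, LinearMap.neg_apply,
    Module.End.one_apply, Pi.neg_apply]
  linear_combination (- f A) * sg_sq i A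

lemma Eop_anti {n : ℕ} {i j : Fin n} (h : i ≠ j) :
    Eop i * Eop j + Eop j * Eop i = (0 : Module.End ℝ (RepV n)) := by
  refine LinearMap.ext fun f => funext fun A => ?_
  simp only [Module.End.mul_apply, Eop_apply, LinearMap.add_apply, Pi.add_apply,
    LinearMap.zero_apply, Pi.zero_apply]
  rw [flipB_comm j i]
  rcases lt_or_gt_of_ne h with h | h
  · rw [sg_flip_gt h, sg_flip_lt h]; ring
  · rw [sg_flip_gt h, sg_flip_lt h]; ring

/-- The operator representing a vector. -/
def vop (n : ℕ) : (Fin n → ℝ) →ₗ[ℝ] Module.End ℝ (RepV n) where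
  toFun v := ∑ i, v i • Eop i
  map_add' v w := by simp [add_smul, Finset.sum_add_distrib]
  map_smul' r v := by simp [mul_smul, Finset.smul_sum]

lemma vop_apply {n : ℕ} (v : Fin n → ℝ) : vop n v = ∑ i, v i • Eop i := rfl

lemma Qf_apply {n : ℕ} (v : Fin n → ℝ) : Qf n v = - ∑ i, v i * v i := by
  simp [Qf, QuadraticMap.weightedSumSquares_apply]

lemma vop_sq {n : ℕ} (v : Fin n → ℝ) :
    vop n v * vop n v = algebraMap ℝ (Module.End ℝ (RepV n)) (Qf n v) := by
  have h1 : vop n v * vop n v = ∑ i, ∑ j, (v i * v j) • (Eop i * Eop j) := by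
    rw [vop_apply, Finset.sum_mul_sum]
    refine Finset.sum_congr rfl fun i _ => Finset.sum_congr rfl fun j _ => ?_
    rw [smul_mul_smul_comm]
  have h2 : vop n v * vop n v = ∑ i, ∑ j, (v i * v j) • (Eop j * Eop i) := by
    rw [h1, Finset.sum_comm]
    refine Finset.sum_congr rfl fun i _ => Finset.sum_congr rfl fun j _ => ?_
    rw [mul_comm]
  have h3 : vop n v * vop n v + vop n v * vop n v
      = (2 : ℝ) • algebraMap ℝ (Module.End ℝ (RepV n)) (Qf n v) := by
    nth_rewrite 1 [h1]
    rw [h2, ← Finset.sum_add_distrib, Qf_apply, Algebra.algebraMap_eq_smul_one, smul_smul,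
      mul_neg, Finset.mul_sum, neg_smul, Finset.sum_smul, ← Finset.sum_neg_distrib]
    refine Finset.sum_congr rfl fun i _ => ?_
    rw [← Finset.sum_add_distrib, Finset.sum_eq_single i]
    · rw [Eop_sq, ← smul_add, ← two_smul ℝ (-1 : Module.End ℝ (RepV n)), smul_smul, smul_neg,
        mul_comm]
    · intro j _ hj
      rw [← smul_add, Eop_anti (Ne.symm hj), smul_zero]
    · simp
  rw [← two_smul ℝ] at h3
  exact smul_right_injective _ (two_ne_zero) h3

/-- The representation of `Cl_n`. -/
def rho (n : ℕ) : Cl n →ₐ[ℝ] Module.End ℝ (RepV n) :=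
  CliffordAlgebra.lift (Qf n) ⟨vop n, vop_sq⟩

lemma rho_ι {n : ℕ} (v : Fin n → ℝ) : rho n (CliffordAlgebra.ι (Qf n) v) = vop n v := by
  simp [rho]

lemma rho_eCl {n : ℕ} (i : Fin n) : rho n (eCl i) = Eop i := by
  unfold eCl clVec
  rw [rho_ι, vop_apply, Finset.sum_eq_single i]
  · simp
  · intro j _ hj; simp [hj]
  · simp

/-- The inner product on the representation space. -/
def ip {n : ℕ} (f g : RepV n) : ℝ := ∑ A, f A * g A

lemma ip_Eop {n : ℕ} (i : Fin n) (f g : RepV n) : ip (Eop i f) g = - ip f (Eop i g) := by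
  unfold ip
  rw [← Equiv.sum_comp (Function.Involutive.toPerm (flipB i) (flipB_flipB i)),
    ← Finset.sum_neg_distrib]
  refine Finset.sum_congr rfl fun A _ => ?_
  change sg i (flipB i A) * f (flipB i (flipB i A)) * g (flipB i A)
    = -(f A * (sg i A * g (flipB i A)))
  rw [flipB_flipB, sg_flip_same]
  ring

lemma ip_add_left {n : ℕ} (f f' g : RepV n) : ip (f + f') g = ip f g + ip f' g := by
  simp [ip, add_mul, Finset.sum_add_distrib]

lemma ip_add_right {n : ℕ} (f g g' : RepV n) : ip f (g + g') = ip f g + ip f g' := by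
  simp [ip, mul_add, Finset.sum_add_distrib]

lemma ip_smul_left {n : ℕ} (r : ℝ) (f g : RepV n) : ip (r • f) g = r * ip f g := by
  simp [ip, Finset.mul_sum, mul_assoc]

lemma ip_smul_right {n : ℕ} (r : ℝ) (f g : RepV n) : ip f (r • g) = r * ip f g := by
  simp only [ip, Finset.mul_sum, Pi.smul_apply, smul_eq_mul]
  refine Finset.sum_congr rfl fun A _ => by ring

lemma ip_vop {n : ℕ} (v : Fin n → ℝ) (f g : RepV n) : ip (vop n v f) g = - ip f (vop n v g) := by
  have hl : ip (vop n v f) g = ∑ i, v i * ip (Eop i f) g := by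
    simp only [vop_apply, LinearMap.sum_apply, LinearMap.smul_apply, ip, Finset.sum_apply,
      Finset.sum_mul, Finset.mul_sum, Pi.smul_apply, smul_eq_mul]
    rw [Finset.sum_comm]
    refine Finset.sum_congr rfl fun i _ => Finset.sum_congr rfl fun j _ => by ring
  have hr : ip f (vop n v g) = ∑ i, v i * ip f (Eop i g) := by
    simp only [vop_apply, LinearMap.sum_apply, LinearMap.smul_apply, ip, Finset.sum_apply,
      Finset.mul_sum, Pi.smul_apply, smul_eq_mul]
    rw [Finset.sum_comm]
    refine Finset.sum_congr rfl fun i _ => Finset.sum_congr rfl fun j _ => by ring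
  rw [hl, hr, ← Finset.sum_neg_distrib]
  refine Finset.sum_congr rfl fun i _ => ?_
  rw [ip_Eop]; ring

lemma clConj_mul {n : ℕ} (a b : Cl n) : clConj (a * b) = clConj b * clConj a := by
  simp [clConj, CliffordAlgebra.reverse.map_mul]

lemma clConj_add {n : ℕ} (a b : Cl n) : clConj (a + b) = clConj a + clConj b := by
  simp [clConj]

lemma clConj_neg {n : ℕ} (a : Cl n) : clConj (-a) = -clConj a := by
  simp [clConj]

lemma clConj_zero {n : ℕ} : clConj (0 : Cl n) = 0 := by
  simp [clConj]

lemma clConj_one {n : ℕ} : clConj (1 : Cl n) = 1 := by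
  simp [clConj]

lemma clConj_algebraMap {n : ℕ} (r : ℝ) :
    clConj (algebraMap ℝ (Cl n) r) = algebraMap ℝ (Cl n) r := by
  simp [clConj]

lemma clConj_ι {n : ℕ} (v : Fin n → ℝ) :
    clConj (CliffordAlgebra.ι (Qf n) v) = - CliffordAlgebra.ι (Qf n) v := by
  simp [clConj]

lemma clConj_clConj {n : ℕ} (a : Cl n) : clConj (clConj a) = a := by
  simp [clConj, ← CliffordAlgebra.reverse_involute]

lemma ip_rho {n : ℕ} (a : Cl n) : ∀ f g : RepV n, ip (rho n a f) g = ip f (rho n (clConj a) g) := by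
  induction a using CliffordAlgebra.induction with
  | algebraMap r =>
    intro f g
    rw [clConj_algebraMap]
    simp [Module.algebraMap_end_apply, ip_smul_left, ip_smul_right]
  | ι v =>
    intro f g
    rw [clConj_ι, map_neg, rho_ι, ip_vop, LinearMap.neg_apply, ← neg_one_smul ℝ (vop n v g),
      ip_smul_right]
    ring
  | mul a b ha hb =>
    intro f g
    rw [clConj_mul, map_mul, map_mul, Module.End.mul_apply, Module.End.mul_apply, ha, hb]
  | add a b ha hb =>
    intro f g
    rw [clConj_add, map_add, map_add, LinearMap.add_apply, LinearMap.add_apply, ip_add_left,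
      ip_add_right, ha, hb]

/-! ### Monomials -/

lemma eCl_sq {n : ℕ} (i : Fin n) : eCl i * eCl i = (-1 : Cl n) := by
  unfold eCl clVec
  rw [CliffordAlgebra.ι_sq_scalar, Qf_apply, Finset.sum_eq_single i]
  · simp
  · intro j _ hj; simp [hj]
  · simp

lemma eCl_anti {n : ℕ} {i j : Fin n} (h : i ≠ j) :
    (eCl i * eCl j : Cl n) = -(eCl j * eCl i) := by
  apply eq_neg_of_add_eq_zero_left
  unfold eCl clVec
  rw [CliffordAlgebra.ι_mul_ι_add_swap, QuadraticMap.polar, Qf_apply, Qf_apply, Qf_apply,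
    sub_eq_add_neg, sub_eq_add_neg, neg_neg, neg_neg, ← Finset.sum_neg_distrib,
    ← Finset.sum_add_distrib, ← Finset.sum_add_distrib, Finset.sum_eq_zero, map_zero]
  intro k _
  by_cases hi : k = i
  · subst hi
    simp [h]
  · simp [hi]

/-- Partial monomial along a list. -/
def PL {n : ℕ} (L : List (Fin n)) (A : Fin n → Bool) : Cl n :=
  (L.map (fun j => bif A j then eCl j else 1)).prod

lemma PL_nil {n : ℕ} (A : Fin n → Bool) : PL [] A = 1 := by simp [PL]

lemma PL_cons {n : ℕ} (j : Fin n) (L : List (Fin n)) (A : Fin n → Bool) :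
    PL (j :: L) A = (bif A j then eCl j else 1) * PL L A := by simp [PL]

lemma PL_flip {n : ℕ} (i : Fin n) (L : List (Fin n)) (h : i ∉ L) (A : Fin n → Bool) :
    PL L (flipB i A) = PL L A := by
  unfold PL
  congr 1
  refine List.map_congr_left fun j hj => ?_
  have : j ≠ i := by rintro rfl; exact h hj
  rw [flipB_ne this]

lemma e_mul_PL {n : ℕ} (i : Fin n) (A : Fin n → Bool) (L : List (Fin n)) (hL : L.Nodup)
    (hi : i ∈ L) :
    eCl i * PL L A = PL L (flipB i A) ∨ eCl i * PL L A = - PL L (flipB i A) := by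
  induction L with
  | nil => simp at hi
  | cons j L ih =>
    rw [List.nodup_cons] at hL
    rw [PL_cons, PL_cons]
    by_cases hij : j = i
    · subst hij
      rw [PL_flip _ _ hL.1, flipB_same]
      cases h : A j
      · left; simp
      · right; simp [← mul_assoc, eCl_sq]
    · have hi' : i ∈ L := by
        rcases List.mem_cons.1 hi with h | h
        · exact absurd h.symm hij
        · exact h
      rw [flipB_ne hij]
      cases h : A j
      · simpa using ih hL.2 hi'
      · simp only [cond_true]
        rw [← mul_assoc, eCl_anti (Ne.symm hij), neg_mul, mul_assoc]
        rcases ih hL.2 hi' with h | h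
        · right; rw [h]
        · left; rw [h]; simp

/-- The basis monomial `e_A`. -/
def mono {n : ℕ} (A : Fin n → Bool) : Cl n := PL (List.finRange n) A

lemma e_mul_mono {n : ℕ} (i : Fin n) (A : Fin n → Bool) :
    eCl i * mono A = mono (flipB i A) ∨ eCl i * mono A = - mono (flipB i A) :=
  e_mul_PL i A _ (List.nodup_finRange n) (List.mem_finRange i)

/-- The empty index. -/
def ff (n : ℕ) : Fin n → Bool := fun _ => false

lemma mono_ff (n : ℕ) : mono (ff n) = 1 := by
  simp [mono, PL, ff]

/-- The delta function at `A`. -/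
def dl {n : ℕ} (A : Fin n → Bool) : RepV n := Pi.single A 1

lemma dl_same {n : ℕ} (A : Fin n → Bool) : dl A A = 1 := by simp [dl]

lemma dl_ne {n : ℕ} {A B : Fin n → Bool} (h : B ≠ A) : dl A B = 0 := by simp [dl, h]

lemma Eop_dl {n : ℕ} (i : Fin n) (A : Fin n → Bool) :
    Eop i (dl A) = dl (flipB i A) ∨ Eop i (dl A) = - dl (flipB i A) := by
  have key : Eop i (dl A) = sg i (flipB i A) • dl (flipB i A) := by
    funext B
    rw [Eop_apply, Pi.smul_apply, smul_eq_mul]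
    by_cases h : B = flipB i A
    · subst h; rw [flipB_flipB, dl_same, dl_same]
    · have h' : flipB i B ≠ A := by
        rintro rfl; exact h (flipB_flipB i B).symm
      rw [dl_ne h, dl_ne h']; simp
  rcases sg_pm i (flipB i A) with h | h
  · left; rw [key, h, one_smul]
  · right; rw [key, h, neg_one_smul]

lemma rho_PL {n : ℕ} (A : Fin n → Bool) (L : List (Fin n)) (hL : L.Nodup) :
    rho n (PL L A) (dl (ff n)) = dl (fun j => A j && decide (j ∈ L)) ∨
    rho n (PL L A) (dl (ff n)) = - dl (fun j => A j && decide (j ∈ L)) := by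
  induction L with
  | nil => left; simp [PL_nil]; rfl
  | cons j L ih =>
    rw [List.nodup_cons] at hL
    have ih := ih hL.2
    rw [PL_cons, map_mul, Module.End.mul_apply]
    cases h : A j
    · have e : (fun k => A k && decide (k ∈ j :: L)) = (fun k => A k && decide (k ∈ L)) := by
        funext k
        by_cases hk : k = j
        · subst hk; simp [h]
        · simp [hk]
      rw [e]
      simpa using ih
    · have e : (fun k => A k && decide (k ∈ j :: L))
          = flipB j (fun k => A k && decide (k ∈ L)) := by
        funext k
        by_cases hk : k = j
        · subst hk; rw [flipB_same]; simp [h, hL.1]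
        · rw [flipB_ne hk]; simp [hk]
      rw [e, cond_true, rho_eCl]
      rcases ih with h1 | h1 <;> rw [h1] <;>
        rcases Eop_dl j (fun k => A k && decide (k ∈ L)) with h2 | h2
      · left; rw [h2]
      · right; rw [h2]
      · right; rw [map_neg, h2]
      · left; rw [map_neg, h2, neg_neg]

/-- The coefficient function of a Clifford number. -/
def cf {n : ℕ} (a : Cl n) : RepV n := rho n a (dl (ff n))

lemma cf_add {n : ℕ} (a b : Cl n) : cf (a + b) = cf a + cf b := by simp [cf]
lemma cf_neg {n : ℕ} (a : Cl n) : cf (-a) = - cf a := by simp [cf]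
lemma cf_zero {n : ℕ} : cf (0 : Cl n) = 0 := by simp [cf]
lemma cf_one {n : ℕ} : cf (1 : Cl n) = dl (ff n) := by simp [cf]
lemma cf_nsmul {n : ℕ} (N : ℕ) (a : Cl n) : cf (N • a) = N • cf a := by
  induction N with
  | zero => simp [cf_zero]
  | succ k ih => rw [succ_nsmul, cf_add, ih, succ_nsmul]

lemma cf_mono {n : ℕ} (A : Fin n → Bool) : cf (mono A) = dl A ∨ cf (mono A) = - dl A := by
  have := rho_PL A (List.finRange n) (List.nodup_finRange n)
  simpa [cf, mono] using this

lemma exists_eps {n : ℕ} (A : Fin n → Bool) : ∃ e : ℤ, (e = 1 ∨ e = -1) ∧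
    cf (mono A) = (e : ℝ) • dl A := by
  rcases cf_mono A with h | h
  · exact ⟨1, Or.inl rfl, by simp [h]⟩
  · exact ⟨-1, Or.inr rfl, by simp [h]⟩

/-- The sign of the monomial `e_A`. -/
def eps {n : ℕ} (A : Fin n → Bool) : ℤ := (exists_eps A).choose

lemma eps_pm {n : ℕ} (A : Fin n → Bool) : eps A = 1 ∨ eps A = -1 := (exists_eps A).choose_spec.1

lemma cf_mono_eps {n : ℕ} (A : Fin n → Bool) : cf (mono A) = (eps A : ℝ) • dl A :=
  (exists_eps A).choose_spec.2

/-- `A` is supported in the first `p` indices. -/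
def Supp {n : ℕ} (p : ℕ) (A : Fin n → Bool) : Prop := ∀ i : Fin n, p ≤ (i : ℕ) → A i = false

/-- The properties of elements of the order read off from coefficients. -/
def Nice {n : ℕ} (p : ℕ) (a : Cl n) : Prop :=
  (∀ A, ∃ z : ℤ, cf a A = z) ∧ (∀ A, ¬ Supp p A → cf a A = 0) ∧
    a = ∑ A, (cf a A * (eps A : ℝ)) • mono A

lemma Nice_add {n : ℕ} {p : ℕ} {a b : Cl n} (ha : Nice p a) (hb : Nice p b) :
    Nice p (a + b) := by
  refine ⟨fun A => ?_, fun A hA => ?_, ?_⟩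
  · obtain ⟨z, hz⟩ := ha.1 A
    obtain ⟨w, hw⟩ := hb.1 A
    exact ⟨z + w, by rw [cf_add, Pi.add_apply, hz, hw]; push_cast; rfl⟩
  · rw [cf_add, Pi.add_apply, ha.2.1 A hA, hb.2.1 A hA, add_zero]
  · conv_lhs => rw [ha.2.2, hb.2.2]
    rw [← Finset.sum_add_distrib, cf_add]
    refine Finset.sum_congr rfl fun A _ => ?_
    rw [Pi.add_apply, add_mul, add_smul]

lemma Nice_neg {n : ℕ} {p : ℕ} {a : Cl n} (ha : Nice p a) : Nice p (-a) := by
  refine ⟨fun A => ?_, fun A hA => ?_, ?_⟩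
  · obtain ⟨z, hz⟩ := ha.1 A
    exact ⟨-z, by rw [cf_neg, Pi.neg_apply, hz]; push_cast; rfl⟩
  · rw [cf_neg, Pi.neg_apply, ha.2.1 A hA, neg_zero]
  · conv_lhs => rw [ha.2.2]
    rw [← Finset.sum_neg_distrib, cf_neg]
    refine Finset.sum_congr rfl fun A _ => ?_
    rw [Pi.neg_apply, neg_mul, neg_smul]

lemma Nice_zero {n : ℕ} {p : ℕ} : Nice p (0 : Cl n) :=
  ⟨fun A => ⟨0, by simp [cf_zero]⟩, fun A _ => by simp [cf_zero], by simp [cf_zero]⟩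

lemma eps_sq {n : ℕ} (A : Fin n → Bool) : (eps A : ℝ) * eps A = 1 := by
  rcases eps_pm A with h | h <;> simp [h]

lemma Nice_mono {n : ℕ} {p : ℕ} {A : Fin n → Bool} (hA : Supp p A) : Nice p (mono A) := by
  rw [Nice, cf_mono_eps]
  refine ⟨fun B => ?_, fun B hB => ?_, ?_⟩
  · by_cases h : B = A
    · subst h; exact ⟨eps B, by simp [dl_same]⟩
    · exact ⟨0, by simp [dl_ne h]⟩
  · have h : B ≠ A := by rintro rfl; exact hB hA
    simp [dl_ne h]
  · rw [Finset.sum_eq_single A]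
    · simp [dl_same, eps_sq]
    · intro B _ h; simp [dl_ne h]
    · simp

lemma Supp_flip {n p : ℕ} {i : Fin n} (hi : (i : ℕ) < p) {A : Fin n → Bool} (hA : Supp p A) :
    Supp p (flipB i A) := by
  intro j hj
  rw [flipB_ne (by rintro rfl; omega)]
  exact hA j hj

/-- The additive span of the monomials. -/
def Spn (n p : ℕ) : AddSubgroup (Cl n) :=
  AddSubgroup.closure {x | ∃ A : Fin n → Bool, Supp p A ∧ x = mono A}

lemma Spn_mul {n p : ℕ} {a : Cl n} (ha : a ∈ Op n p) : ∀ x ∈ Spn n p, a * x ∈ Spn n p := by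
  unfold Op at ha
  rw [SetLike.mem_coe] at ha
  induction ha using Subring.closure_induction with
  | mem a ha =>
    obtain ⟨i, hi, rfl⟩ := ha
    intro x hx
    unfold Spn at hx
    induction hx using AddSubgroup.closure_induction with
    | mem x hx =>
      obtain ⟨A, hA, rfl⟩ := hx
      have : mono (flipB i A) ∈ Spn n p :=
        AddSubgroup.subset_closure ⟨_, Supp_flip hi hA, rfl⟩
      rcases e_mul_mono i A with h | h
      · rw [h]; exact this
      · rw [h]; exact neg_mem this
    | zero => rw [mul_zero]; exact zero_mem _
    | add x y _ _ hx hy => rw [mul_add]; exact add_mem hx hy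
    | neg x _ hx => rw [mul_neg]; exact neg_mem hx
  | zero => intro x _; rw [zero_mul]; exact zero_mem _
  | one => intro x hx; rwa [one_mul]
  | add a b _ _ ha hb => intro x hx; rw [add_mul]; exact add_mem (ha x hx) (hb x hx)
  | neg a _ ha => intro x hx; rw [neg_mul]; exact neg_mem (ha x hx)
  | mul a b _ _ ha hb => intro x hx; rw [mul_assoc]; exact ha _ (hb x hx)

lemma Nice_Op {n p : ℕ} {a : Cl n} (ha : a ∈ Op n p) : Nice p a := by
  have h1 : (1 : Cl n) ∈ Spn n p :=
    AddSubgroup.subset_closure ⟨ff n, fun _ _ => rfl, (mono_ff n).symm⟩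
  have h2 := Spn_mul ha 1 h1
  rw [mul_one] at h2
  clear ha
  unfold Spn at h2
  induction h2 using AddSubgroup.closure_induction with
  | mem x hx => obtain ⟨A, hA, rfl⟩ := hx; exact Nice_mono hA
  | zero => exact Nice_zero
  | add x y _ _ hx hy => exact Nice_add (hx) (hy)
  | neg x _ hx => exact Nice_neg hx

lemma norm_eq {n : ℕ} {a : Cl n} {s : ℝ} (h : clConj a * a = algebraMap ℝ (Cl n) s) :
    ∑ A, cf a A * cf a A = s := by
  have : ip (cf a) (cf a) = s := by
    unfold cf
    rw [ip_rho, ← Module.End.mul_apply, ← map_mul, h]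
    simp only [AlgHom.commutes, Module.algebraMap_end_apply, ip_smul_right]
    unfold ip
    rw [Finset.sum_eq_single (ff n)]
    · simp [dl_same]
    · intro B _ hB; simp [dl_ne hB]
    · simp
  exact this

/-- The set of units `± e_A`. -/
def US (n p : ℕ) : Set (Cl n) := {u | ∃ A : Fin n → Bool, Supp p A ∧ (u = mono A ∨ u = - mono A)}

lemma mem_US {n p : ℕ} {a : Cl n} (ha : Nice p a) (h : ∑ A, cf a A * cf a A = 1) :
    a ∈ US n p := by
  obtain ⟨hz, hs, hr⟩ := ha
  choose z hz using hz
  have h1 : ∑ A, z A * z A = 1 := by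
    have : (∑ A, (z A : ℝ) * z A) = 1 := by rw [← h]; simp [hz]
    exact_mod_cast this
  obtain ⟨A, -, hA⟩ : ∃ A ∈ Finset.univ, z A * z A ≠ 0 := by
    apply Finset.exists_ne_zero_of_sum_ne_zero
    rw [h1]; exact one_ne_zero
  have hpos : 0 < z A * z A := lt_of_le_of_ne (mul_self_nonneg _) (Ne.symm hA)
  rw [← Finset.add_sum_erase _ _ (Finset.mem_univ A)] at h1
  have hnn : 0 ≤ ∑ B ∈ Finset.univ.erase A, z B * z B :=
    Finset.sum_nonneg fun B _ => mul_self_nonneg _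
  have h0 : ∑ B ∈ Finset.univ.erase A, z B * z B = 0 := by omega
  have hone : z A * z A = 1 := by omega
  rw [Finset.sum_eq_zero_iff_of_nonneg (fun B _ => mul_self_nonneg _)] at h0
  have hB : ∀ B, B ≠ A → z B = 0 := fun B hB =>
    mul_self_eq_zero.1 (h0 B (Finset.mem_erase.2 ⟨hB, Finset.mem_univ _⟩))
  refine ⟨A, ?_, ?_⟩
  · by_contra hc
    have := hs A hc
    rw [hz] at this
    have : z A = 0 := by exact_mod_cast this
    exact hA (by rw [this]; rfl)
  · rw [Finset.sum_eq_single A (fun B _ h => by rw [hz, hB B h]; simp) (by simp), hz] at hr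
    rcases mul_self_eq_one_iff.1 hone with h1 | h1 <;> rcases eps_pm A with h2 | h2 <;>
      rw [h1, h2] at hr
    · left; simpa using hr
    · right; simpa using hr
    · right; simpa using hr
    · left; simpa using hr

/-- Extension of a Boolean vector by `false`. -/
def extB {n p : ℕ} (B : Fin p → Bool) : Fin n → Bool :=
  fun i => if h : (i : ℕ) < p then B ⟨i, h⟩ else false

/-- Parametrization of the units. -/
def upar (n p : ℕ) (x : Bool × (Fin p → Bool)) : Cl n :=
  bif x.1 then mono (extB x.2) else - mono (extB x.2)

lemma cf_upar {n p : ℕ} (x : Bool × (Fin p → Bool)) :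
    cf (upar n p x) = (bsgn x.1 * (eps (n := n) (extB x.2) : ℝ)) • dl (extB x.2) := by
  obtain ⟨b, B⟩ := x
  cases b
  · simp [upar, cf_neg, cf_mono_eps, bsgn]
  · simp [upar, cf_mono_eps, bsgn]

lemma eps_ne {n : ℕ} (A : Fin n → Bool) : (eps A : ℝ) ≠ 0 := by
  intro h; have := eps_sq A; rw [h] at this; simp at this

lemma bsgn_ne (b : Bool) : bsgn b ≠ 0 := by
  intro h; have := bsgn_sq b; rw [h] at this; simp at this

lemma upar_inj {n p : ℕ} (hpn : p ≤ n) : Function.Injective (upar n p) := by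
  rintro ⟨b, B⟩ ⟨c, C⟩ h
  have h1 := congrArg cf h
  rw [cf_upar, cf_upar] at h1
  have h2 : (extB B : Fin n → Bool) = extB C := by
    by_contra hne
    have := congrFun h1 (extB B)
    simp [dl_same, dl_ne hne, bsgn_ne] at this
    exact eps_ne (n := n) (extB B) (by rw [this]; simp)
  have h3 : B = C := by
    funext i
    have := congrFun h2 ⟨i, lt_of_lt_of_le i.2 hpn⟩
    simpa [extB] using this
  subst h3
  have h4 := congrFun h1 (extB B)
  simp only [Pi.smul_apply, dl_same, smul_eq_mul, mul_one] at h4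
  have h5 := mul_right_cancel₀ (eps_ne _) h4
  have h6 : b = c := by
    revert h5
    cases b <;> cases c <;> simp [bsgn] <;> norm_num
  rw [h6]

lemma upar_range {n p : ℕ} : Set.range (upar n p) = US n p := by
  ext u
  constructor
  · rintro ⟨⟨b, B⟩, rfl⟩
    refine ⟨extB B, ?_, ?_⟩
    · intro i hi; simp [extB, not_lt.2 hi]
    · cases b
      · right; rfl
      · left; rfl
  · rintro ⟨A, hA, h⟩
    have e : (extB (fun i : Fin p => if h : (i : ℕ) < n then A ⟨i, h⟩ else false)
        : Fin n → Bool) = A := by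
      funext i
      by_cases hi : (i : ℕ) < p
      · simp [extB, hi]
      · simp [extB, hi, hA i (not_lt.1 hi)]
    rcases h with h | h
    · exact ⟨(true, _), by rw [h]; exact congrArg mono e⟩
    · exact ⟨(false, _), by rw [h]; exact congrArg (fun A => - mono A) e⟩

lemma US_finite {n p : ℕ} : (US n p).Finite := by
  rw [← upar_range]; exact Set.finite_range _

lemma US_card {n p : ℕ} (hpn : p ≤ n) : Nat.card (US n p) = 2 ^ (p + 1) := by
  rw [← upar_range, Nat.card_range_of_injective (upar_inj hpn)]
  simp [Nat.card_eq_fintype_card, pow_succ, mul_comm]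

lemma nat_of_sum {n p : ℕ} {a : Cl n} {s : ℝ} (ha : Nice p a)
    (h : ∑ A, cf a A * cf a A = s) : ∃ z : ℕ, s = z := by
  obtain ⟨hz, -, -⟩ := ha
  choose z hz using hz
  refine ⟨∑ A, (z A * z A).toNat, ?_⟩
  rw [← h, Nat.cast_sum]
  refine Finset.sum_congr rfl fun A _ => ?_
  have : (((z A * z A).toNat : ℤ) : ℝ) = ((z A * z A : ℤ) : ℝ) := by
    rw [Int.toNat_of_nonneg (mul_self_nonneg _)]
  rw [hz]
  push_cast at this
  simpa using this.symm

/-! ### Invariants of the group -/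

lemma Gamma_rec {n p : ℕ} (Q : Matrix (Fin 2) (Fin 2) (Cl n) → Prop) (h1 : Q 1)
    (hm : ∀ M N, Q M → Q N → Q (M * N)) (hJ : Q !![0, -1; 1, 0]) (hJ' : Q !![0, 1; -1, 0])
    (hT : ∀ i : Fin n, (i : ℕ) < p → Q !![1, eCl i; 0, 1])
    (hT' : ∀ i : Fin n, (i : ℕ) < p → Q !![1, - eCl i; 0, 1]) :
    ∀ M ∈ Gamma n p, Q M.val := by
  intro M hM
  have key : Q M.val ∧ Q M⁻¹.val := by
    unfold Gamma at hM
    induction hM using Subgroup.closure_induction with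
    | mem x hx =>
      rcases hx with hx | ⟨i, hi, hx⟩
      · rw [Set.mem_singleton_iff] at hx
        subst hx
        exact ⟨hJ, hJ'⟩
      · subst hx
        exact ⟨hT i hi, hT' i hi⟩
    | one => rw [inv_one]; exact ⟨h1, h1⟩
    | mul x y _ _ hx hy =>
      rw [mul_inv_rev]
      exact ⟨hm _ _ hx.1 hy.1, hm _ _ hy.2 hx.2⟩
    | inv x _ hx => rw [inv_inv]; exact ⟨hx.2, hx.1⟩
  exact key.1

lemma m2_mul {n : ℕ} (a b c d a' b' c' d' : Cl n) :
    !![a, b; c, d] * !![a', b'; c', d']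
      = !![a * a' + b * c', a * b' + b * d'; c * a' + d * c', c * b' + d * d'] := by
  rw [Matrix.mul_fin_two]

lemma m2_eta {n : ℕ} (M : Matrix (Fin 2) (Fin 2) (Cl n)) :
    M = !![M 0 0, M 0 1; M 1 0, M 1 1] := Matrix.eta_fin_two M

/-- Conjugate transpose. -/
def hT {n : ℕ} (M : Matrix (Fin 2) (Fin 2) (Cl n)) : Matrix (Fin 2) (Fin 2) (Cl n) :=
  !![clConj (M 0 0), clConj (M 1 0); clConj (M 0 1), clConj (M 1 1)]

lemma hT_mul {n : ℕ} (M N : Matrix (Fin 2) (Fin 2) (Cl n)) : hT (M * N) = hT N * hT M := by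
  unfold hT
  rw [m2_mul]
  simp only [Matrix.mul_apply, Fin.sum_univ_two, clConj_add, clConj_mul]

/-- Pseudo-inverse. -/
def dag {n : ℕ} (M : Matrix (Fin 2) (Fin 2) (Cl n)) : Matrix (Fin 2) (Fin 2) (Cl n) :=
  !![reverse (M 1 1), - reverse (M 0 1); - reverse (M 1 0), reverse (M 0 0)]

lemma dag_mul {n : ℕ} (M N : Matrix (Fin 2) (Fin 2) (Cl n)) : dag (M * N) = dag N * dag M := by
  unfold dag
  rw [m2_mul]
  simp only [Matrix.mul_apply, Fin.sum_univ_two, map_add, CliffordAlgebra.reverse.map_mul, neg_add,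
    neg_mul, mul_neg, neg_neg, add_comm]

lemma one_m2 {n : ℕ} : (1 : Matrix (Fin 2) (Fin 2) (Cl n)) = !![1, 0; 0, 1] :=
  Matrix.one_fin_two

lemma dag_Gamma {n p : ℕ} : ∀ M ∈ Gamma n p, M.val * dag M.val = 1 := by
  apply Gamma_rec (fun M => M * dag M = 1)
  · simp [dag, one_m2]
  · intro M N hM hN
    rw [dag_mul, ← mul_assoc, mul_assoc M, hN, mul_one, hM]
  · simp [dag, one_m2]
  · simp [dag, one_m2]
  · intro i _
    simp [dag, one_m2, eCl, clVec]
  · intro i _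
    simp [dag, one_m2, eCl, clVec]

/-- The space of Hermitian-type matrices. -/
def inW {n : ℕ} (X : Matrix (Fin 2) (Fin 2) (Cl n)) : Prop :=
  ∃ (s t : ℝ) (v : Fin n → ℝ), X = !![algebraMap ℝ (Cl n) s, CliffordAlgebra.ι (Qf n) v;
    - CliffordAlgebra.ι (Qf n) v, algebraMap ℝ (Cl n) t]

lemma inW_T {n : ℕ} (w : Fin n → ℝ) (X : Matrix (Fin 2) (Fin 2) (Cl n)) (hX : inW X) :
    inW (!![1, CliffordAlgebra.ι (Qf n) w; 0, 1] * X *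
      hT !![1, CliffordAlgebra.ι (Qf n) w; 0, 1]) := by
  obtain ⟨s, t, v, rfl⟩ := hX
  refine ⟨s - QuadraticMap.polar (Qf n) w v - t * Qf n w, t, v + t • w, ?_⟩
  have hc : algebraMap ℝ (Cl n) t * CliffordAlgebra.ι (Qf n) w
      = CliffordAlgebra.ι (Qf n) w * algebraMap ℝ (Cl n) t := Algebra.commutes _ _
  simp only [hT, m2_mul, Matrix.of_apply, Matrix.cons_val', Matrix.cons_val_zero,
    Matrix.cons_val_one, Matrix.cons_val_fin_one, clConj_one, clConj_zero, clConj_ι]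
  have hv : CliffordAlgebra.ι (Qf n) (v + t • w) = CliffordAlgebra.ι (Qf n) v
      + CliffordAlgebra.ι (Qf n) w * algebraMap ℝ (Cl n) t := by
    rw [map_add, map_smul, Algebra.smul_def, hc]
  rw [hv]
  simp only [map_sub, map_mul, ← CliffordAlgebra.ι_mul_ι_add_swap,
    ← CliffordAlgebra.ι_sq_scalar]
  have hc2 : algebraMap ℝ (Cl n) t * (CliffordAlgebra.ι (Qf n) w * CliffordAlgebra.ι (Qf n) w)
      = CliffordAlgebra.ι (Qf n) w * algebraMap ℝ (Cl n) t * CliffordAlgebra.ι (Qf n) w := by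
    rw [← mul_assoc, hc]
  rw [hc2]
  congr 1
  ext i j
  fin_cases i <;> fin_cases j
  · simp; noncomm_ring
  · simp
  · simp [hc]; abel
  · simp

lemma inW_J {n : ℕ} (X : Matrix (Fin 2) (Fin 2) (Cl n)) (hX : inW X) :
    inW (!![0, -1; 1, 0] * X * hT !![0, -1; 1, 0]) := by
  obtain ⟨s, t, v, rfl⟩ := hX
  refine ⟨t, s, v, ?_⟩
  simp [hT, clConj_zero, clConj_one, clConj_neg, Algebra.algebraMap_eq_smul_one]

lemma inW_J' {n : ℕ} (X : Matrix (Fin 2) (Fin 2) (Cl n)) (hX : inW X) :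
    inW (!![0, 1; -1, 0] * X * hT !![0, 1; -1, 0]) := by
  obtain ⟨s, t, v, rfl⟩ := hX
  refine ⟨t, s, v, ?_⟩
  simp [hT, clConj_zero, clConj_one, clConj_neg, Algebra.algebraMap_eq_smul_one]

lemma inW_Gamma {n p : ℕ} : ∀ M ∈ Gamma n p, ∀ X, inW X → inW (M.val * X * hT M.val) := by
  apply Gamma_rec (fun M => ∀ X, inW X → inW (M * X * hT M))
  · intro X hX
    have : hT (1 : Matrix (Fin 2) (Fin 2) (Cl n)) = 1 := by
      simp [hT, clConj_zero, clConj_one, one_m2]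
    rw [this, one_mul, mul_one]; exact hX
  · intro M N hM hN X hX
    have := hM _ (hN X hX)
    rw [hT_mul]
    simpa only [mul_assoc] using this
  · exact inW_J
  · exact inW_J'
  · intro i _
    exact inW_T _
  · intro i _
    have := inW_T (n := n) (- Pi.single i 1)
    rw [map_neg] at this
    exact this

/-- The order as a subring. -/
def OpR (n p : ℕ) : Subring (Cl n) :=
  Subring.closure {a : Cl n | ∃ i : Fin n, (i : ℕ) < p ∧ a = eCl i}

lemma ent_Gamma {n p : ℕ} : ∀ M ∈ Gamma n p, ∀ i j, M.val i j ∈ OpR n p := by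
  have he : ∀ i : Fin n, (i : ℕ) < p → eCl i ∈ OpR n p := fun i hi =>
    Subring.subset_closure ⟨i, hi, rfl⟩
  apply Gamma_rec (fun M => ∀ i j, M i j ∈ OpR n p)
  · intro i j
    rw [Matrix.one_apply]
    split_ifs
    · exact one_mem _
    · exact zero_mem _
  · intro M N hM hN i j
    rw [Matrix.mul_apply]
    exact sum_mem fun k _ => mul_mem (hM _ _) (hN _ _)
  · intro i j
    fin_cases i <;> fin_cases j <;> simp [one_mem, zero_mem]
  · intro i j
    fin_cases i <;> fin_cases j <;> simp [one_mem, zero_mem]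
  · intro k hk i j
    fin_cases i <;> fin_cases j <;> simp [one_mem, zero_mem, he k hk]
  · intro k hk i j
    fin_cases i <;> fin_cases j <;> simp [one_mem, zero_mem, he k hk]

lemma ent_Op {n p : ℕ} {M : GL2 n} (hM : M ∈ Gamma n p) (i j : Fin 2) : ent M i j ∈ Op n p :=
  ent_Gamma M hM i j

lemma inv_val {n p : ℕ} {M : GL2 n} (hM : M ∈ Gamma n p) : M⁻¹.val = dag M.val :=
  (Units.inv_eq_of_mul_eq_one_right (dag_Gamma M hM))

lemma conj_scalar {n p : ℕ} {M : GL2 n} (hM : M ∈ Gamma n p) :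
    ∃ s : ℝ, M.val 0 0 * clConj (M.val 0 0) = algebraMap ℝ (Cl n) s := by
  have h0 : inW (!![1, 0; 0, 0] : Matrix (Fin 2) (Fin 2) (Cl n)) := ⟨1, 0, 0, by simp⟩
  obtain ⟨s, t, v, h⟩ := inW_Gamma M hM _ h0
  refine ⟨s, ?_⟩
  have := congrFun (congrFun h 0) 0
  simpa [hT, Matrix.mul_apply, Fin.sum_univ_two] using this

/-- Structure of elements with `c = 0`. -/
lemma upper_rel {n p : ℕ} {M : GL2 n} (hM : M ∈ Gamma n p) (hc : ent M 1 0 = 0) :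
    M.val 0 0 * reverse (M.val 1 1) = 1 ∧ reverse (M.val 1 1) * M.val 0 0 = 1 ∧
    M⁻¹.val 0 0 = reverse (M.val 1 1) ∧ M⁻¹.val 1 0 = 0 := by
  unfold ent at hc
  have h1 := dag_Gamma M hM
  have h2 : dag M.val * M.val = 1 := by rw [← inv_val hM]; exact M.inv_mul
  have e1 := congrFun (congrFun h1 0) 0
  have e2 := congrFun (congrFun h2 0) 0
  refine ⟨?_, ?_, ?_, ?_⟩
  · simpa [dag, Matrix.mul_apply, Fin.sum_univ_two, hc] using e1
  · simpa [dag, Matrix.mul_apply, Fin.sum_univ_two, hc] using e2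
  · rw [inv_val hM]; simp [dag]
  · rw [inv_val hM]; simp [dag, hc]

lemma upper_US {n p : ℕ} {M : GL2 n} (hM : M ∈ Gamma n p) (hc : ent M 1 0 = 0) :
    ent M 0 0 ∈ US n p := by
  obtain ⟨r1, r2, r3, r4⟩ := upper_rel hM hc
  obtain ⟨s, hs⟩ := conj_scalar hM
  have hMi := inv_mem hM
  obtain ⟨t, ht⟩ := conj_scalar hMi
  have na := Nice_Op (ent_Op hM 0 0)
  have nb := Nice_Op (ent_Op hMi 0 0)
  unfold ent at na nb ⊢
  rw [r3] at ht nb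
  generalize M.val 0 0 = a at *
  generalize reverse (M.val 1 1) = b at *
  have hs' : clConj a * a = algebraMap ℝ (Cl n) s := by
    calc clConj a * a = b * a * (clConj a * a) := by rw [r2, one_mul]
      _ = b * (a * clConj a) * a := by noncomm_ring
      _ = algebraMap ℝ (Cl n) s := by
        rw [hs, ← Algebra.commutes, mul_assoc, r2, mul_one]
  have ht' : clConj b * b = algebraMap ℝ (Cl n) t := by
    calc clConj b * b = a * b * (clConj b * b) := by rw [r1, one_mul]
      _ = a * (b * clConj b) * b := by noncomm_ring
      _ = algebraMap ℝ (Cl n) t := by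
        rw [ht, ← Algebra.commutes, mul_assoc, r1, mul_one]
  have hst : s * t = 1 := by
    have h1 : algebraMap ℝ (Cl n) (s * t) = algebraMap ℝ (Cl n) 1 := by
      rw [map_one, map_mul, ← hs', ← Algebra.commutes, ← ht]
      calc b * clConj b * (clConj a * a) = b * (clConj (a * b)) * a := by
            rw [clConj_mul]; noncomm_ring
        _ = 1 := by rw [r1, clConj_one, mul_one, r2]
    exact (algebraMap ℝ (Cl n)).injective h1
  have fs := norm_eq hs'
  have ft := norm_eq ht'
  apply mem_US na
  rw [fs]
  obtain ⟨z, hz⟩ : ∃ z : ℕ, s = z := nat_of_sum na fs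
  obtain ⟨w, hw⟩ : ∃ w : ℕ, t = w := nat_of_sum nb ft
  rw [hz, hw] at hst
  have : z * w = 1 := by exact_mod_cast hst
  rw [hz, Nat.eq_one_of_mul_eq_one_right this]
  simp

/-! ### Existence of diagonal elements and counting -/

/-- `a` occurs as the upper left entry of a diagonal element. -/
def DG (n p : ℕ) (a : Cl n) : Prop := ∃ M ∈ Gamma n p, ∃ d : Cl n, M.val = !![a, 0; 0, d]

lemma DG_one {n p : ℕ} : DG n p 1 := ⟨1, one_mem _, 1, by simp [one_m2]⟩

lemma DG_mul {n p : ℕ} {a b : Cl n} (ha : DG n p a) (hb : DG n p b) : DG n p (a * b) := by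
  obtain ⟨M, hM, d, h⟩ := ha
  obtain ⟨N, hN, e, h'⟩ := hb
  exact ⟨M * N, mul_mem hM hN, d * e, by rw [Units.val_mul, h, h', m2_mul]; simp⟩

lemma J_mem {n p : ℕ} : Jmat n ∈ Gamma n p := Subgroup.subset_closure (Or.inl rfl)

lemma DG_neg_one {n p : ℕ} : DG n p (-1) :=
  ⟨Jmat n * Jmat n, mul_mem J_mem J_mem, -1, by rw [Units.val_mul]; simp [Jmat]⟩

lemma DG_e {n p : ℕ} {i : Fin n} (hi : (i : ℕ) < p) : DG n p (eCl i) := by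
  have hT : Tmat (eCl i) ∈ Gamma n p := Subgroup.subset_closure (Or.inr ⟨i, hi, rfl⟩)
  have h1 : DG n p (-eCl i) := by
    refine ⟨Tmat (eCl i) * (Jmat n * (Tmat (eCl i))⁻¹ * (Jmat n)⁻¹) * Tmat (eCl i) * (Jmat n)⁻¹,
      mul_mem (mul_mem (mul_mem hT (mul_mem (mul_mem J_mem (inv_mem hT)) (inv_mem J_mem))) hT)
        (inv_mem J_mem), eCl i, ?_⟩
    have hTi : (Tmat (eCl i))⁻¹.val = !![1, -eCl i; 0, 1] := rfl
    have hJi : (Jmat n)⁻¹.val = !![0, 1; -1, 0] := rfl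
    simp only [Units.val_mul, hTi, hJi]
    simp [Tmat, Jmat, eCl_sq]
  have := DG_mul DG_neg_one h1
  simpa using this

lemma DG_PL {n p : ℕ} {A : Fin n → Bool} (hA : Supp p A) (L : List (Fin n)) :
    DG n p (PL L A) := by
  induction L with
  | nil => rw [PL_nil]; exact DG_one
  | cons j L ih =>
    rw [PL_cons]
    refine DG_mul ?_ ih
    cases h : A j
    · exact DG_one
    · refine DG_e ?_
      by_contra hc
      rw [hA j (not_lt.1 hc)] at h
      exact Bool.false_ne_true h

lemma DG_US {n p : ℕ} {u : Cl n} (hu : u ∈ US n p) : DG n p u := by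
  obtain ⟨A, hA, rfl | rfl⟩ := hu
  · exact DG_PL hA _
  · have := DG_mul DG_neg_one (DG_PL hA (List.finRange n))
    simpa [mono] using this

/-- Same upper left entry and `c = 0` implies the same coset. -/
lemma same_coset {n p : ℕ} {M M' : GL2 n} (hM : M ∈ Gamma n p) (hM' : M' ∈ Gamma n p)
    (hc : ent M 1 0 = 0) (hc' : ent M' 1 0 = 0) (h : ent M 0 0 = ent M' 0 0) :
    IsTransMat (M * M'⁻¹) := by
  have hP : M * M'⁻¹ ∈ Gamma n p := mul_mem hM (inv_mem hM')
  obtain ⟨r1, r2, r3, r4⟩ := upper_rel hM' hc'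
  have hca : ent (M * M'⁻¹) 1 0 = 0 := by
    unfold ent at hc ⊢
    rw [Units.val_mul, Matrix.mul_apply, Fin.sum_univ_two, hc, r4]; simp
  have h00 : (M * M'⁻¹).val 0 0 = 1 := by
    unfold ent at h
    rw [Units.val_mul, Matrix.mul_apply, Fin.sum_univ_two, r4, r3, h, r1]; simp
  obtain ⟨q1, -, -, -⟩ := upper_rel hP hca
  rw [h00, one_mul] at q1
  have h11 : (M * M'⁻¹).val 1 1 = 1 := by
    have := congrArg (reverse (Q := Qf n)) q1
    simpa only [CliffordAlgebra.reverse_reverse, CliffordAlgebra.reverse.map_one] using this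
  refine ⟨(M * M'⁻¹).val 0 1, ?_⟩
  unfold ent at hca
  conv_lhs => rw [m2_eta (M * M'⁻¹).val, h00, h11, hca]

lemma trans_one {n : ℕ} : IsTransMat (1 : GL2 n) := ⟨0, by simp [one_m2]⟩

/-- The entry map on cosets. -/
def entMap {n p : ℕ} {Λ : Subgroup (GL2 n)} (hΛ : Λ ≤ Gamma n p) {κ : Type} {S : κ → GL2 n}
    (hS : IsRepSystem n Λ κ S) (i : {i : κ // ent (S i) 1 0 = 0}) : US n p :=
  ⟨ent (S i.1) 0 0, upper_US (hΛ (hS.1 i.1)) i.2⟩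

lemma entMap_inj {n p : ℕ} {Λ : Subgroup (GL2 n)} (hΛ : Λ ≤ Gamma n p) {κ : Type} {S : κ → GL2 n}
    (hS : IsRepSystem n Λ κ S) : Function.Injective (entMap hΛ hS) := by
  rintro ⟨i, hi⟩ ⟨j, hj⟩ h
  have h' : ent (S i) 0 0 = ent (S j) 0 0 := congrArg Subtype.val h
  have hT := same_coset (hΛ (hS.1 i)) (hΛ (hS.1 j)) hi hj h'
  obtain ⟨k, -, hk⟩ := hS.2 (S i) (hS.1 i)
  have e1 := hk i ⟨1, trans_one, one_mem _, by simp⟩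
  have e2 := hk j ⟨S i * (S j)⁻¹, hT, mul_mem (hS.1 i) (inv_mem (hS.1 j)), by simp⟩
  exact Subtype.ext (e1.trans e2.symm)

lemma rep_entries {n : ℕ} {M T N : GL2 n} (hT : IsTransMat T) (h : M = T * N)
    (hc : ent M 1 0 = 0) : ent N 1 0 = 0 ∧ ent N 0 0 = ent M 0 0 := by
  obtain ⟨b, hb⟩ := hT
  unfold ent at *
  have h1 : M.val = T.val * N.val := by rw [h]; rfl
  have h2 : M.val 1 0 = N.val 1 0 := by
    rw [h1, hb]; simp [Matrix.mul_apply, Fin.sum_univ_two]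
  have h3 : N.val 1 0 = 0 := by rw [← h2, hc]
  refine ⟨h3, ?_⟩
  rw [h1, hb]; simp [Matrix.mul_apply, Fin.sum_univ_two, h3]

lemma coset_nonempty {n : ℕ} {Λ : Subgroup (GL2 n)} {κ : Type} {S : κ → GL2 n}
    (hS : IsRepSystem n Λ κ S) : Nonempty {i : κ // ent (S i) 1 0 = 0} := by
  obtain ⟨i, ⟨T, hT, -, h⟩, -⟩ := hS.2 1 (one_mem _)
  exact ⟨⟨i, (rep_entries hT h (by simp [ent])).1⟩⟩

lemma cong_one {n p N : ℕ} (hN : 3 ≤ N) {u : Cl n} (hu : u ∈ US n p)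
    (h : inNOp n p N (u - 1)) : u = 1 := by
  obtain ⟨y, hy, hyu⟩ := h
  obtain ⟨z, hz⟩ := (Nice_Op hy).1 (ff n)
  have h1 : cf u (ff n) = N * (z : ℝ) + 1 := by
    have : u = N • y + 1 := by rw [← hyu]; simp
    rw [this, cf_add, cf_nsmul, cf_one, Pi.add_apply, Pi.smul_apply, hz, dl_same]
    simp
  obtain ⟨A, hA, hu⟩ := hu
  by_cases hAf : A = ff n
  · subst hAf
    rw [mono_ff] at hu
    rcases hu with hu | hu
    · exact hu
    · exfalso
      rw [hu, cf_neg, cf_one, Pi.neg_apply, dl_same] at h1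
      have h2 : (N : ℤ) * z = -2 := by
        have : (N : ℝ) * z = -2 := by linarith
        exact_mod_cast this
      have h3 : (N : ℤ) ∣ 2 := ⟨-z, by linarith⟩
      have := Int.le_of_dvd (by norm_num) h3
      omega
  · exfalso
    have h0 : cf u (ff n) = 0 := by
      have hm : cf (mono A) (ff n) = 0 := by
        rw [cf_mono_eps, Pi.smul_apply, dl_ne (Ne.symm hAf), smul_zero]
      rcases hu with hu | hu
      · rw [hu, hm]
      · rw [hu, cf_neg, Pi.neg_apply, hm, neg_zero]
    rw [h0] at h1
    have h2 : (N : ℤ) * z = -1 := by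
      have : (N : ℝ) * z = -1 := by linarith
      exact_mod_cast this
    have h3 : (N : ℤ) ∣ 1 := ⟨-z, by linarith⟩
    have := Int.le_of_dvd (by norm_num) h3
    omega

/-- counting the right cosets whose representatives have `c = 0`. -/
theorem stmt11 (n p : ℕ) (hn : 0 < n) (hp : 0 < p) (hpn : p ≤ n - 1)
    (ι : Type) (R : ι → GL2 n) (hR : IsRepSystem n (Gamma n p) ι R) :
    Nat.card {i : ι // ent (R i) 1 0 = 0} = 2 ^ (p + 1) ∧
    (∀ Λ : Subgroup (GL2 n), IsCongruence n p Λ →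
      ∀ (κ : Type) (S : κ → GL2 n), IsRepSystem n Λ κ S →
        1 ≤ Nat.card {i : κ // ent (S i) 1 0 = 0} ∧
        Nat.card {i : κ // ent (S i) 1 0 = 0} ≤ 2 ^ (p + 1)) ∧
    (∀ N : ℕ, 3 ≤ N → ∀ Λ : Subgroup (GL2 n), (Λ : Set (GL2 n)) = GammaN n p N →
      ∀ (κ : Type) (S : κ → GL2 n), IsRepSystem n Λ κ S →
        Nat.card {i : κ // ent (S i) 1 0 = 0} = 1) := by
  have hpn' : p ≤ n := by omega
  haveI : Finite (US n p) := US_finite.to_subtype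
  refine ⟨?_, ?_, ?_⟩
  · rw [← US_card hpn']
    refine Nat.card_congr (Equiv.ofBijective (entMap le_rfl hR) ⟨entMap_inj _ _, ?_⟩)
    rintro ⟨u, hu⟩
    obtain ⟨M, hM, d, hd⟩ := DG_US hu
    obtain ⟨i, ⟨T, hT, -, h⟩, -⟩ := hR.2 M hM
    have hc : ent M 1 0 = 0 := by unfold ent; rw [hd]; simp
    have ha : ent M 0 0 = u := by unfold ent; rw [hd]; simp
    obtain ⟨h1, h2⟩ := rep_entries hT h hc
    exact ⟨⟨i, h1⟩, Subtype.ext (h2.trans ha)⟩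
  · rintro Λ ⟨N, -, -, hΛ⟩ κ S hS
    have hinj := entMap_inj (p := p) hΛ hS
    haveI := coset_nonempty hS
    haveI := Finite.of_injective _ hinj
    refine ⟨Nat.card_pos, ?_⟩
    rw [← US_card hpn']
    exact Nat.card_le_card_of_injective _ hinj
  · intro N hN Λ hΛ κ S hS
    have hle : Λ ≤ Gamma n p := by
      intro M hM
      have : M ∈ GammaN n p N := by rw [← hΛ]; exact hM
      exact this.1
    have hinj := entMap_inj (p := p) hle hS
    have hone : ∀ i : {i : κ // ent (S i) 1 0 = 0}, ent (S i.1) 0 0 = 1 := by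
      rintro ⟨i, hi⟩
      have hm : S i ∈ GammaN n p N := by rw [← hΛ]; exact hS.1 i
      exact cong_one hN (upper_US hm.1 hi) hm.2.1
    rw [Nat.card_eq_one_iff_unique]
    refine ⟨⟨fun i j => hinj (Subtype.ext ?_)⟩, coset_nonempty hS⟩
    exact (hone i).trans (hone j).symm
end
end

section
/- Let n ≥ 4. There exist multi-indices m ∈ ℕ_0^n with |m| ≥ 3 and |m| odd for which the lattice sum Σ_{ω ∈ ℤ^{n−1} \ {0}} q^{(1)}_m(ω) is different from zero, where ℤ^{n−1} = ℤe_1 + … + ℤe_{n−1}. (If all these sums vanished, the n−1-fold periodic monogenic series ε_m(z) = Σ_{ω ∈ ℤ^{n−1}} q^{(1)}_m(z+ω) would coincide with q^{(1)}_m(z), contradicting its periodicity.) -/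
noncomputable section

open CliffordAlgebra Filter

attribute [local instance] Classical.propDecidable

theorem sc_algebraMap {n : ℕ} (r : ℝ) : Sc (algebraMap ℝ (Cl n) r) = r := by
  unfold Sc
  simp [CliffordAlgebra.equivExterior, CliffordAlgebra.changeFormEquiv_apply,
    CliffordAlgebra.changeForm_algebraMap]

theorem clNorm_clVec {n : ℕ} (x : Fin n → ℝ) :
    clNorm (clVec x) = Real.sqrt (∑ i, x i ^ 2) := by
  unfold clNorm
  have h : clVec x * clConj (clVec x) = algebraMap ℝ (Cl n) (∑ i, x i ^ 2) := by
    have h1 : clConj (clVec x) = - clVec x := by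
      simp [clConj, clVec]
    rw [h1, mul_neg]
    unfold clVec
    rw [CliffordAlgebra.ι_sq_scalar, ← map_neg]
    congr 1
    simp [Qf, QuadraticMap.weightedSumSquares_apply, pow_two]
  rw [h, sc_algebraMap]

theorem cl_ext {n : ℕ} {a b : Cl n} (h : ∀ φ : Cl n →ₗ[ℝ] ℝ, φ a = φ b) : a = b := by
  rw [← sub_eq_zero, ← Module.forall_dual_apply_eq_zero_iff ℝ]
  intro φ
  rw [map_sub, h φ, sub_self]

theorem clPDeriv_line {n : ℕ} (i : Fin n) (F : (Fin n → ℝ) → Cl n) (x : Fin n → ℝ)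
    (a b : Cl n) (g h g' h' : ℝ → ℝ)
    (hF : ∀ s, F (Function.update x i s) = g s • a + h s • b)
    (hg : ∀ s, HasDerivAt g (g' s) s) (hh : ∀ s, HasDerivAt h (h' s) s) (s : ℝ) :
    clPDeriv i F (Function.update x i s) = g' s • a + h' s • b := by
  have key : ∀ φ : Cl n →ₗ[ℝ] ℝ, HasDerivAt (fun t : ℝ => φ (F (Function.update
      (Function.update x i s) i ((Function.update x i s) i + t)))) (φ (g' s • a + h' s • b)) 0 := by
    intro φ
    simp only [Function.update_idem, Function.update_self, hF, map_add, map_smul, smul_eq_mul]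
    have e1 : HasDerivAt (fun t : ℝ => g (s + t)) (g' s) 0 := by
      apply HasDerivAt.comp_const_add s 0
      simpa using hg s
    have e2 : HasDerivAt (fun t : ℝ => h (s + t)) (h' s) 0 := by
      apply HasDerivAt.comp_const_add s 0
      simpa using hh s
    exact (e1.mul_const _).add (e2.mul_const _)
  have hex : ∃ v : Cl n, ∀ φ : Cl n →ₗ[ℝ] ℝ, HasDerivAt (fun t : ℝ => φ (F (Function.update
      (Function.update x i s) i ((Function.update x i s) i + t)))) (φ v) 0 := ⟨_, key⟩
  unfold clPDeriv
  rw [dif_pos hex]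
  exact cl_ext fun φ => (hex.choose_spec φ).unique (key φ)

theorem hasDerivAt_P {R : ℝ} (hR : 0 < R) (p s : ℝ) :
    HasDerivAt (fun s : ℝ => (R + s ^ 2) ^ p) (2 * p * s * (R + s ^ 2) ^ (p - 1)) s := by
  have h1 : HasDerivAt (fun s : ℝ => R + s ^ 2) (2 * s) s := by
    simpa using (hasDerivAt_pow 2 s).const_add R
  have h2 := h1.rpow_const (p := p) (Or.inl (by positivity))
  convert h2 using 1
  ring

theorem third_deriv {n : ℕ} (i : Fin n) (x : Fin n → ℝ) (hx : x i = 0)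
    (hR : 0 < ∑ j, x j ^ 2) :
    clPDerivIter i 3 (qfun 1) x =
      (-(3 * n) * (∑ j, x j ^ 2) ^ (-(n : ℝ) / 2 - 1)) • eCl i := by
  set R := ∑ j, x j ^ 2 with hRdef
  set p : ℝ := -(n : ℝ) / 2 with hp
  have hF0 : ∀ s, qfun 1 (Function.update x i s) =
      ((R + s ^ 2) ^ p) • clVec x + (s * (R + s ^ 2) ^ p) • eCl i := by
    intro s
    have hsum : ∑ j, (Function.update x i s j) ^ 2 = R + s ^ 2 := by
      rw [hRdef, ← Finset.add_sum_erase _ _ (Finset.mem_univ i),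
        ← Finset.add_sum_erase (a := i) _ (fun j => x j ^ 2) (Finset.mem_univ i)]
      have : ∑ j ∈ Finset.univ.erase i, (Function.update x i s j) ^ 2
          = ∑ j ∈ Finset.univ.erase i, x j ^ 2 := by
        apply Finset.sum_congr rfl
        intro j hj
        rw [Function.update_of_ne (Finset.ne_of_mem_erase hj)]
      rw [this]
      simp [hx]
      ring
    have hvec : clVec (Function.update x i s) = clVec x + s • eCl i := by
      unfold eCl clVec
      rw [← map_smul, ← map_add]
      congr 1
      ext j
      by_cases hj : j = i
      · subst hj; simp [hx]
      · simp [hj]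
    have hpow : ((Real.sqrt (R + s ^ 2)) ^ n)⁻¹ = (R + s ^ 2) ^ p := by
      have h0 : 0 ≤ R + s ^ 2 := by positivity
      rw [Real.sqrt_eq_rpow, ← Real.rpow_natCast, ← Real.rpow_mul h0, ← Real.rpow_neg h0]
      congr 1
      rw [hp]; ring
    unfold qfun qker
    rw [if_pos odd_one, clNorm_clVec, hsum, hvec]
    simp only [Nat.add_sub_cancel]
    rw [hpow, smul_add, smul_smul, mul_comm s]
  have P := hasDerivAt_P hR
  have I : ∀ s : ℝ, HasDerivAt (fun s : ℝ => s) 1 s := fun s => hasDerivAt_id s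
  have I2 : ∀ s : ℝ, HasDerivAt (fun s : ℝ => s ^ 2) (2 * s) s := fun s => by
    simpa using hasDerivAt_pow 2 s
  have I3 : ∀ s : ℝ, HasDerivAt (fun s : ℝ => s ^ 3) (3 * s ^ 2) s := fun s => by
    simpa using hasDerivAt_pow 3 s
  have hF1 := clPDeriv_line i (qfun 1) x (clVec x) (eCl i) _ _
    (fun s => 2 * p * (s * (R + s ^ 2) ^ (p - 1)))
    (fun s => (R + s ^ 2) ^ p + 2 * p * (s ^ 2 * (R + s ^ 2) ^ (p - 1)))
    hF0 (fun s => (P p s).congr_deriv (by ring))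
    (fun s => ((I s).mul (P p s)).congr_deriv (by ring))
  have hF2 := clPDeriv_line i _ x (clVec x) (eCl i) _ _
    (fun s => 2 * p * (R + s ^ 2) ^ (p - 1)
      + 4 * p * (p - 1) * (s ^ 2 * (R + s ^ 2) ^ (p - 1 - 1)))
    (fun s => 6 * p * (s * (R + s ^ 2) ^ (p - 1))
      + 4 * p * (p - 1) * (s ^ 3 * (R + s ^ 2) ^ (p - 1 - 1)))
    hF1 (fun s => (((I s).mul (P (p - 1) s)).const_mul (2 * p)).congr_deriv (by ring))
    (fun s => ((P p s).add (((I2 s).mul (P (p - 1) s)).const_mul (2 * p))).congr_deriv (by ring))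
  have hF3 := clPDeriv_line i _ x (clVec x) (eCl i) _ _
    (fun s => 12 * p * (p - 1) * (s * (R + s ^ 2) ^ (p - 1 - 1))
      + 8 * p * (p - 1) * (p - 1 - 1) * (s ^ 3 * (R + s ^ 2) ^ (p - 1 - 1 - 1)))
    (fun s => 6 * p * (R + s ^ 2) ^ (p - 1)
      + 24 * p * (p - 1) * (s ^ 2 * (R + s ^ 2) ^ (p - 1 - 1))
      + 8 * p * (p - 1) * (p - 1 - 1) * (s ^ 4 * (R + s ^ 2) ^ (p - 1 - 1 - 1)))
    hF2
    (fun s => (((P (p - 1) s).const_mul (2 * p)).add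
        (((I2 s).mul (P (p - 1 - 1) s)).const_mul (4 * p * (p - 1)))).congr_deriv (by ring))
    (fun s => ((((I s).mul (P (p - 1) s)).const_mul (6 * p)).add
        (((I3 s).mul (P (p - 1 - 1) s)).const_mul (4 * p * (p - 1)))).congr_deriv (by ring))
  have hup : Function.update x i 0 = x := by
    rw [← hx, Function.update_eq_self]
  have := hF3 0
  rw [hup] at this
  simp only [clPDerivIter]
  rw [this]
  have : 6 * p = -(3 * n) := by rw [hp]; ring
  simp [this]

theorem multiPDeriv_single {n : ℕ} (i : Fin n) (k : ℕ) (f : (Fin n → ℝ) → Cl n) :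
    multiPDeriv (Pi.single i k) f = clPDerivIter i k f := by
  have aux : ∀ l : List (Fin n), l.Nodup →
      l.foldr (fun j g => clPDerivIter j ((Pi.single i k : Fin n → ℕ) j) g) f =
        if i ∈ l then clPDerivIter i k f else f := by
    intro l
    induction l with
    | nil => simp
    | cons a l ih =>
      intro hnd
      rw [List.nodup_cons] at hnd
      rw [List.foldr_cons, ih hnd.2]
      by_cases hai : a = i
      · subst hai
        simp [hnd.1]
      · have hia : ¬ i = a := fun h => hai h.symm
        simp [hai, hia, clPDerivIter]
  unfold multiPDeriv
  rw [aux _ (List.nodup_finRange n)]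
  simp

theorem lat_aux1 {n : ℕ} (L : Submodule ℤ (Fin n → ℝ)) [DiscreteTopology L]
    (hfin : Module.finrank ℤ L = n) : Summable (fun z : L => ‖z‖ ^ (-(n : ℝ) - 2)) := by
  exact ZLattice.summable_norm_rpow L (-(n : ℝ) - 2) (by rw [hfin]; linarith)

theorem lat_aux2 {n : ℕ} (L : Submodule ℤ (Fin n → ℝ)) (hmem : ∀ ω : Fin n → ℤ, latVec ω ∈ L) :
   Function.Injective (fun ω : Fin n → ℤ => (⟨latVec ω, hmem ω⟩ : L)) := by
    intro a c h
    have h' : latVec a = latVec c := congrArg Subtype.val h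
    funext j
    have := congrFun h' j
    simpa [latVec] using this

theorem lat_summable_aux {n : ℕ} (L : Submodule ℤ (Fin n → ℝ)) [DiscreteTopology L]
    (hfin : Module.finrank ℤ L = n) (hmem : ∀ ω : Fin n → ℤ, latVec ω ∈ L) :
    Summable (fun ω : Fin n → ℤ => ‖latVec ω‖ ^ (-(n : ℝ) - 2)) := by
  have := (lat_aux1 L hfin).comp_injective (lat_aux2 L hmem)
  exact this

theorem lat_mem {n : ℕ} (ω : Fin n → ℤ) :
    latVec ω ∈ Submodule.span ℤ (Set.range (Pi.basisFun ℝ (Fin n))) := by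
  rw [Module.Basis.mem_span_iff_repr_mem]
  intro j
  exact ⟨ω j, by simp [latVec]⟩

theorem lat_finrank (n : ℕ) :
    Module.finrank ℤ (Submodule.span ℤ (Set.range (Pi.basisFun ℝ (Fin n)))) = n := by
  rw [ZLattice.rank ℝ, Module.finrank_fin_fun]

theorem lat_summable {n : ℕ} :
    Summable (fun ω : Fin n → ℤ => ‖latVec ω‖ ^ (-(n : ℝ) - 2)) :=
  lat_summable_aux _ (lat_finrank n) lat_mem

theorem eCl_ne {n : ℕ} (i : Fin n) : eCl i ≠ 0 := by
  intro h
  have h1 := clNorm_clVec (Pi.single i (1 : ℝ))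
  have h2 : clVec (Pi.single i (1 : ℝ)) = 0 := h
  rw [h2] at h1
  simp [clNorm, Sc, Pi.single_apply, ite_pow] at h1

/-- existence of odd multi-indices `m`, `|m| ≥ 3`, for which the lattice sum
`Σ_{ω ∈ ℤ^{n-1}∖{0}} q^{(1)}_m(ω)` (a vector-valued analogue of Riemann's zeta function)
does not vanish. -/
theorem stmt12 (n : ℕ) (hn : 4 ≤ n) :
    ∃ m : Fin n → ℕ, 3 ≤ ∑ i, m i ∧ Odd (∑ i, m i) ∧
      ∃ a : Cl n, a ≠ 0 ∧
        HasClSum (fun ω : {ω : Fin n → ℤ // horPart n ω ∧ ω ≠ 0} =>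
          multiPDeriv m (qfun 1) (latVec ω.1)) a := by

  set i : Fin n := ⟨n - 1, by omega⟩ with hi
  have hRpos : ∀ ω : {ω : Fin n → ℤ // horPart n ω ∧ ω ≠ 0}, 0 < ‖latVec ω.1‖ := by
    intro ω
    rw [norm_pos_iff]
    intro h
    apply ω.2.2
    ext j
    have := congrFun h j
    simpa [latVec] using this
  have hle : ∀ ω : {ω : Fin n → ℤ // horPart n ω ∧ ω ≠ 0},
      ‖latVec ω.1‖ ^ 2 ≤ ∑ j, latVec ω.1 j ^ 2 := by
    intro ω
    have h0 : 0 ≤ ∑ j, latVec ω.1 j ^ 2 := Finset.sum_nonneg fun j _ => sq_nonneg _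
    rw [← Real.le_sqrt (norm_nonneg _) h0, pi_norm_le_iff_of_nonneg (Real.sqrt_nonneg _)]
    intro j
    apply Real.le_sqrt_of_sq_le
    rw [Real.norm_eq_abs, sq_abs]
    exact Finset.single_le_sum (f := fun j => latVec ω.1 j ^ 2) (fun j _ => sq_nonneg _)
      (Finset.mem_univ j)
  have hpos : ∀ ω : {ω : Fin n → ℤ // horPart n ω ∧ ω ≠ 0},
      0 < ∑ j, latVec ω.1 j ^ 2 := fun ω => lt_of_lt_of_le (pow_pos (hRpos ω) 2) (hle ω)
  have hsum : Summable (fun ω : {ω : Fin n → ℤ // horPart n ω ∧ ω ≠ 0} =>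
      (∑ j, latVec ω.1 j ^ 2) ^ (-(n : ℝ) / 2 - 1)) := by
    refine Summable.of_nonneg_of_le (fun ω => (Real.rpow_pos_of_pos (hpos ω) _).le) ?_
      (lat_summable.comp_injective Subtype.val_injective)
    intro ω
    have hn0 : (0 : ℝ) ≤ n := Nat.cast_nonneg n
    have h1 := Real.rpow_le_rpow_of_nonpos (pow_pos (hRpos ω) 2) (hle ω)
      (z := -(n : ℝ) / 2 - 1) (by linarith)
    refine h1.trans (le_of_eq ?_)
    rw [← Real.rpow_natCast, ← Real.rpow_mul (hRpos ω).le]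
    simp only [Function.comp]
    congr 1
    push_cast
    ring
  set S := ∑' ω : {ω : Fin n → ℤ // horPart n ω ∧ ω ≠ 0},
      (∑ j, latVec ω.1 j ^ 2) ^ (-(n : ℝ) / 2 - 1) with hS
  have hSpos : 0 < S := by
    let w : Fin n → ℤ := Pi.single ⟨0, by omega⟩ 1
    have hw : horPart n w ∧ w ≠ 0 := by
      refine ⟨?_, by simp [w]⟩
      intro j hj
      apply Pi.single_eq_of_ne
      intro h
      rw [h] at hj
      simp at hj
      omega
    exact hsum.tsum_pos (fun ω => (Real.rpow_pos_of_pos (hpos ω) _).le) ⟨w, hw⟩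
      (Real.rpow_pos_of_pos (hpos ⟨w, hw⟩) _)
  refine ⟨Pi.single i 3, by simp, by simp; decide, (-(3 * n) * S) • eCl i, ?_, ?_⟩
  · have hn0 : (n : ℝ) ≠ 0 := by
      have : n ≠ 0 := by omega
      exact_mod_cast this
    refine smul_ne_zero (mul_ne_zero ?_ hSpos.ne') (eCl_ne i)
    simpa using hn0
  · intro φ
    have hterm : ∀ ω : {ω : Fin n → ℤ // horPart n ω ∧ ω ≠ 0},
        φ (multiPDeriv (Pi.single i 3) (qfun 1) (latVec ω.1)) =
          -(3 * n) * (∑ j, latVec ω.1 j ^ 2) ^ (-(n : ℝ) / 2 - 1) * φ (eCl i) := by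
      intro ω
      rw [multiPDeriv_single, third_deriv i _ (by simp [latVec, ω.2.1 i rfl]) (hpos ω), map_smul,
        smul_eq_mul]
    simp only [hterm, map_smul, smul_eq_mul]
    exact (hsum.hasSum.mul_left _).mul_right _
end
end
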